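/- Let R1 and R2 be relations over attribute sets U1 and U2 such that π_{U1}(R1 ⋈ R2) ⊆ R1, let F be a filter over U1 ∪ U2, and set S = R1 ⋈ R2. Then (R1 ∖ π_{U1}S) ∪ (π_{U1}S ∖ π_{U1}σ_F S) ≡ R1 ∖ π_{U1}σ_F S. -/

import Mathlib

noncomputable section
open Classical

attribute [local instance 10] Classical.propDecidable

namespace RA

variable {A Δ : Type} [DecidableEq A] [DecidableEq Δ]

/-- Three-valued logic: true, false, unknown (error). -/
inductive TV where
  | tt | ff | unk
deriving DecidableEq

/-- Kleene conjunction. -/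
def TV.and : TV → TV → TV
  | .ff, _ => .ff
  | _, .ff => .ff
  | .tt, .tt => .tt
  | _, _ => .unk

/-- Kleene negation. -/
def TV.not : TV → TV
  | .tt => .ff
  | .ff => .tt
  | .unk => .unk

mutual
/-- Terms over attributes `A` and domain `Δ`: attributes, constants and conditionals. -/
inductive Term (A Δ : Type) where
  | attr : A → Term A Δ
  | const : Δ → Term A Δ
  | ite : Filter A Δ → Term A Δ → Term A Δ → Term A Δ

/-- RA filters: `isNull` on a (finite) set of terms, equality, conjunction, negation. -/
inductive Filter (A Δ : Type) where
  | isNull : List (Term A Δ) → Filter A Δ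
  | eq : Term A Δ → Term A Δ → Filter A Δ
  | and : Filter A Δ → Filter A Δ → Filter A Δ
  | not : Filter A Δ → Filter A Δ
end

/-- Disjunction: `F1 ∨ F2 = ¬(¬F1 ∧ ¬F2)`. -/
def Filter.or (F1 F2 : Filter A Δ) : Filter A Δ := .not ((Filter.not F1).and (Filter.not F2))

/-- The tautological filter ⊤ (`isNull` of the empty set of terms is always true). -/
def Filter.tru : Filter A Δ := .isNull []

/-- A tuple over a set of attributes: `none` marks attributes outside the set. -/
abbrev Tuple (A Δ : Type) := A → Option Δ

mutual
/-- Evaluation of a term on a tuple (`null` is the distinguished null value of `Δ`). -/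
def Term.eval (null : Δ) (t : Tuple A Δ) : Term A Δ → Δ
  | .attr a => (t a).getD null
  | .const c => c
  | .ite F v v' => if F.eval null t = TV.tt then v.eval null t else v'.eval null t

def Term.evalList (null : Δ) (t : Tuple A Δ) : List (Term A Δ) → List Δ
  | [] => []
  | v :: vs => v.eval null t :: Term.evalList null t vs

/-- Three-valued evaluation of a filter on a tuple. -/
def Filter.eval (null : Δ) (t : Tuple A Δ) : Filter A Δ → TV
  | .isNull V => if ∀ d ∈ Term.evalList null t V, d = null then .tt else .ff
  | .eq v v' =>
      if v.eval null t = null ∨ v'.eval null t = null then .unk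
      else if v.eval null t = v'.eval null t then .tt else .ff
  | .and F1 F2 => (F1.eval null t).and (F2.eval null t)
  | .not F => (F.eval null t).not
end

mutual
/-- Attributes occurring in a term. -/
def Term.attrs : Term A Δ → Finset A
  | .attr a => {a}
  | .const _ => ∅
  | .ite F v v' => F.attrs ∪ v.attrs ∪ v'.attrs

def Term.attrsList : List (Term A Δ) → Finset A
  | [] => ∅
  | v :: vs => v.attrs ∪ Term.attrsList vs

/-- Attributes occurring in a filter. -/
def Filter.attrs : Filter A Δ → Finset A
  | .isNull V => Term.attrsList V
  | .eq v v' => v.attrs ∪ v'.attrs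
  | .and F1 F2 => F1.attrs ∪ F2.attrs
  | .not F => F.attrs
end

/-- A term is over `U` if all its attributes are in `U`. -/
def Term.over (v : Term A Δ) (U : Finset A) : Prop := v.attrs ⊆ U

/-- A filter is over `U` if all its attributes are in `U`. -/
def Filter.over (F : Filter A Δ) (U : Finset A) : Prop := F.attrs ⊆ U

/-- A tuple is over `U` if its domain is exactly `U`. -/
def Tuple.isOver (t : Tuple A Δ) (U : Finset A) : Prop := ∀ a, (t a).isSome ↔ a ∈ U

/-- A relation is a bag (multiset) of tuples. -/
abbrev Rel (A Δ : Type) := Multiset (Tuple A Δ)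

/-- A relation is over `U` if all its tuples are. -/
def Rel.isOver (R : Rel A Δ) (U : Finset A) : Prop := ∀ t ∈ R, t.isOver U

/-- Selection σ_F. -/
def select (null : Δ) (F : Filter A Δ) (R : Rel A Δ) : Rel A Δ :=
  R.filter (fun t => F.eval null t = .tt)

/-- Restriction of a tuple to the attributes in `U`. -/
def Tuple.restrict (t : Tuple A Δ) (U : Finset A) : Tuple A Δ :=
  fun a => if a ∈ U then t a else none

/-- Projection π_U (bag semantics: multiplicities are added up). -/
def proj (U : Finset A) (R : Rel A Δ) : Rel A Δ := R.map (·.restrict U)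

/-- Bag difference: `(R1 ∖ R2)(t) = R1(t)` if `t ∉ R2` and `0` otherwise. -/
def bdiff (R1 R2 : Rel A Δ) : Rel A Δ := R1.filter (fun t => t ∉ R2)

/-- Compatibility of tuples: equal and non-null on the shared attributes. -/
def Compat (null : Δ) (t1 t2 : Tuple A Δ) : Prop :=
  ∀ a, (t1 a).isSome → (t2 a).isSome → (t1 a = t2 a ∧ t1 a ≠ some null)

/-- `t1 ⊕ t2`: the common extension of two (compatible) tuples. -/
def Tuple.merge (t1 t2 : Tuple A Δ) : Tuple A Δ :=
  fun a => (t1 a).or (t2 a)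

/-- Natural join. -/
def join (null : Δ) (R1 R2 : Rel A Δ) : Rel A Δ :=
  (R1.product R2).filterMap
    (fun p => if Compat null p.1 p.2 then some (p.1.merge p.2) else none)

/-- Natural join with a filter: `R1 ⋈_F R2 = σ_F (R1 ⋈ R2)`. -/
def joinF (null : Δ) (F : Filter A Δ) (R1 R2 : Rel A Δ) : Rel A Δ :=
  select null F (join null R1 R2)

/-- Padding of a tuple with `null` on the attributes of `V`. -/
def Tuple.pad (null : Δ) (V : Finset A) (t : Tuple A Δ) : Tuple A Δ :=
  fun a => if a ∈ V then (t a).or (some null) else t a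

/-- Outer union of `R1` over `U1` and `R2` over `U2`:
each relation is padded with nulls on the attributes missing from it. -/
def ounion (null : Δ) (U1 U2 : Finset A) (R1 R2 : Rel A Δ) : Rel A Δ :=
  R1.map (Tuple.pad null (U2 \ U1)) + R2.map (Tuple.pad null (U1 \ U2))

/-- Left join `R1 ⟕_F R2 = (R1 ⋈_F R2) ⊎ (R1 ∖ π_{U1}(R1 ⋈_F R2))`
for `R1` over `U1` and `R2` over `U2`. -/
def ljoin (null : Δ) (U1 U2 : Finset A) (F : Filter A Δ) (R1 R2 : Rel A Δ) : Rel A Δ :=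
  ounion null (U1 ∪ U2) U1 (joinF null F R1 R2) (bdiff R1 (proj U1 (joinF null F R1 R2)))

/-- Natural left join `R1 ⟕ R2 = R1 ⟕_⊤ R2`. -/
def nljoin (null : Δ) (U1 U2 : Finset A) (R1 R2 : Rel A Δ) : Rel A Δ :=
  ljoin null U1 U2 Filter.tru R1 R2

/-- Extension ν_{u↦v}. -/
def extend (null : Δ) (u : A) (v : Term A Δ) (R : Rel A Δ) : Rel A Δ :=
  R.map (fun t a => if a = u then some (v.eval null t) else t a)

/-- Duplicate elimination δ. -/
def dedup (R : Rel A Δ) : Rel A Δ := R.dedup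

/-- Extended renaming ρ^V_{{u/f(u) | u ∈ S}} at the level of tuples:
each attribute `u ∈ S` receives the value of the term `f u` (evaluated on the original
tuple) and the attributes of `V ∖ S` are projected away. -/
def renameFun (null : Δ) (V S : Finset A) (f : A → Term A Δ) (t : Tuple A Δ) : Tuple A Δ :=
  fun a => if a ∈ S then some ((f a).eval null t) else if a ∈ V then none else t a

/-- Extended renaming ρ^V_{{u/f(u) | u ∈ S}}. -/
def rename (null : Δ) (V S : Finset A) (f : A → Term A Δ) (R : Rel A Δ) : Rel A Δ :=
  R.map (renameFun null V S f)

/-- Renaming of the attribute `uold` into `unew` at the level of tuples. -/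
def renameAttrT (unew uold : A) (t : Tuple A Δ) : Tuple A Δ :=
  fun a => if a = unew then t uold else if a = uold then none else t a

/-- `R[unew/uold]`: the relation `R` with the attribute `uold` renamed to `unew`. -/
def renameAttr (unew uold : A) (R : Rel A Δ) : Rel A Δ := R.map (renameAttrT unew uold)

/-- `coalesce(v, v') = if(¬isNull(v), v, v')`. -/
def Term.coalesce (v v' : Term A Δ) : Term A Δ := .ite (.not (.isNull [v])) v v'

/-- The filter `⋀_{u ∈ K} ¬isNull(u)`. -/
def notNullAll (K : Finset A) : Filter A Δ :=
  K.toList.foldr (fun u acc => (Filter.not (.isNull [.attr u])).and acc) Filter.tru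

mutual
/-- `nullify_S`: replace every occurrence of an attribute from `S` by the constant null. -/
def Term.nullify (null : Δ) (S : Finset A) : Term A Δ → Term A Δ
  | .attr a => if a ∈ S then .const null else .attr a
  | .const c => .const c
  | .ite F v v' => .ite (F.nullify null S) (v.nullify null S) (v'.nullify null S)

def Term.nullifyList (null : Δ) (S : Finset A) : List (Term A Δ) → List (Term A Δ)
  | [] => []
  | v :: vs => v.nullify null S :: Term.nullifyList null S vs

/-- `nullify_S` on filters. -/
def Filter.nullify (null : Δ) (S : Finset A) : Filter A Δ → Filter A Δ
  | .isNull V => .isNull (Term.nullifyList null S V)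
  | .eq v v' => .eq (v.nullify null S) (v'.nullify null S)
  | .and F1 F2 => .and (F1.nullify null S) (F2.nullify null S)
  | .not F => .not (F.nullify null S)
end

/-- p-equivalence of filters over `U`: they are ⊤ on the same tuples over `U`. -/
def pequiv (null : Δ) (U : Finset A) (F1 F2 : Filter A Δ) : Prop :=
  ∀ t : Tuple A Δ, t.isOver U → (F1.eval null t = TV.tt ↔ F2.eval null t = TV.tt)

end RA

namespace RA

variable {A Δ : Type} [DecidableEq A] [DecidableEq Δ]

/-- Restricting `t1 ⊕ t2` to the attributes of `t1` gives back `t1`. -/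
theorem Tuple.restrict_merge_left {t1 t2 : Tuple A Δ} {U1 : Finset A} (h : t1.isOver U1) :
    (t1.merge t2).restrict U1 = t1 := by
  funext a
  by_cases ha : a ∈ U1
  · obtain ⟨d, hd⟩ := Option.isSome_iff_exists.mp ((h a).mpr ha)
    simp [Tuple.restrict, Tuple.merge, ha, hd]
  · have hn : t1 a = none := by simpa using mt (h a).mp ha
    simp [Tuple.restrict, ha, hn]

/-- A tuple of `R1` compatible with some tuple of `R2` occurs in `π_{U1}(R1 ⋈ R2)` at least as
often as in `R1`. -/
theorem replicate_le_proj_join {null : Δ} {U1 : Finset A} {R1 R2 : Rel A Δ} {t t2 : Tuple A Δ}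
    {n : ℕ} (ht : t.isOver U1) (hn : Multiset.replicate n t ≤ R1) (h2 : t2 ∈ R2)
    (hc : Compat null t t2) : Multiset.replicate n t ≤ proj U1 (join null R1 R2) := by
  have hprod : Multiset.replicate n (t, t2) ≤ R1.product R2 := by
    obtain ⟨R, rfl⟩ := Multiset.exists_cons_of_mem h2
    calc Multiset.replicate n (t, t2)
        = (Multiset.replicate n t).map (fun s => (s, t2)) := by rw [Multiset.map_replicate]
      _ ≤ R1.map (fun s => (s, t2)) := Multiset.map_le_map hn
      _ ≤ R1.map (fun s => (s, t2)) + R1 ×ˢ R := Multiset.le_add_right _ _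
      _ = R1 ×ˢ (t2 ::ₘ R) := (Multiset.product_cons _ _ _).symm
  have hjoin : Multiset.replicate n (t.merge t2) ≤ join null R1 R2 := by
    refine le_trans (le_of_eq ?_) (Multiset.filterMap_le_filterMap _ hprod)
    clear hn hprod
    induction n with
    | zero => simp
    | succ n ih =>
      rw [Multiset.replicate_succ, Multiset.replicate_succ,
        Multiset.filterMap_cons_some _ _ _ (b := t.merge t2) (by simp [hc]), ih]
  have hproj := Multiset.map_le_map (f := (Tuple.restrict · U1)) hjoin
  rwa [Multiset.map_replicate, Tuple.restrict_merge_left ht] at hproj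

/-- Every tuple of `π_{U1}(R1 ⋈ R2)` comes from a tuple of `R1` compatible with one of `R2`. -/
theorem exists_compat_of_mem_proj_join {null : Δ} {U1 : Finset A} {R1 R2 : Rel A Δ}
    {t : Tuple A Δ} (hR1 : R1.isOver U1) (ht : t ∈ proj U1 (join null R1 R2)) :
    t ∈ R1 ∧ ∃ t2 ∈ R2, Compat null t t2 := by
  obtain ⟨s, hs, rfl⟩ := Multiset.mem_map.mp ht
  obtain ⟨⟨t1, t2⟩, hp, he⟩ := (Multiset.mem_filterMap _ _).mp hs
  obtain ⟨h1, h2⟩ := Multiset.mem_product.mp hp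
  obtain ⟨hc, hm⟩ := Option.ite_none_right_eq_some.mp he
  obtain rfl := Option.some.inj hm
  rw [Tuple.restrict_merge_left (hR1 t1 h1)]
  exact ⟨h1, t2, h2, hc⟩

theorem count_le_count_proj_join {null : Δ} {U1 : Finset A} {R1 R2 : Rel A Δ} {t : Tuple A Δ}
    (hR1 : R1.isOver U1) (ht : t ∈ proj U1 (join null R1 R2)) :
    R1.count t ≤ (proj U1 (join null R1 R2)).count t := by
  obtain ⟨h1, t2, h2, hc⟩ := exists_compat_of_mem_proj_join hR1 ht
  exact Multiset.le_count_iff_replicate_le.mpr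
    (replicate_le_proj_join (hR1 t h1) (Multiset.le_count_iff_replicate_le.mp le_rfl) h2 hc)

theorem proj_select_le (null : Δ) (F : Filter A Δ) (U : Finset A) (R : Rel A Δ) :
    proj U (select null F R) ≤ proj U R :=
  Multiset.map_le_map (Multiset.filter_le _ _)

theorem count_bdiff (R1 R2 : Rel A Δ) (t : Tuple A Δ) :
    (bdiff R1 R2).count t = if t ∈ R2 then 0 else R1.count t := by
  simp [bdiff, Multiset.count_filter]

theorem stmt11 (null : Δ) (U1 U2 : Finset A) (R1 R2 : Rel A Δ) (F : Filter A Δ)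
    (hR1 : R1.isOver U1) (hR2 : R2.isOver U2) (hF : F.over (U1 ∪ U2))
    (hsub : proj U1 (join null R1 R2) ≤ R1) :
    bdiff R1 (proj U1 (join null R1 R2))
        + bdiff (proj U1 (join null R1 R2)) (proj U1 (select null F (join null R1 R2)))
      = bdiff R1 (proj U1 (select null F (join null R1 R2))) := by
  ext t
  rw [Multiset.count_add, count_bdiff, count_bdiff, count_bdiff]
  by_cases hS : t ∈ proj U1 (join null R1 R2)
  · rw [if_pos hS, zero_add, le_antisymm (Multiset.count_le_of_le t hsub)
      (count_le_count_proj_join hR1 hS)]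
  · have hF : t ∉ proj U1 (select null F (join null R1 R2)) :=
      mt (Multiset.mem_of_le (proj_select_le null F U1 _)) hS
    rw [if_neg hS, if_neg hF, if_neg hF, Multiset.count_eq_zero_of_notMem hS, add_zero]

end RA
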